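/- Let 0 ≤ γ < 1, δ > 0, g > 0, ν > 0, α ≥ 1, κ₁, κ₂ ∈ ℝ, and let ζ̄ ∈ ℝ satisfy 1 − ζ̄ > 0 and 1/δ + ζ̄ > 0; set f̄ = (1−ζ̄)(1/δ+ζ̄)/((1−ζ̄) + γ(1/δ+ζ̄)). Let k ≠ 0 be real and ω ∈ ℂ. There exists (ζ₀, v₀) ∈ ℂ² with (ζ₀, v₀) ≠ (0, 0) satisfying the two equations −iω·ζ₀ + f̄·ik·v₀ = 0 and (1 + ναk²)·(−iω·v₀ + ((α−1)/α)·(γ+δ)·g·ik·ζ₀) + (1/α)·(γ+δ)·g·ik·ζ₀ − ν(κ₂−κ₁)·ζ̄·k²·(γ+δ)·g·ik·ζ₀/(1 + ναk²) = 0, if and only if ω² = g·f̄·k²·(γ+δ)·(1 + ν(α−1)k² − ν(κ₂−κ₁)k²ζ̄/(1 + ναk²))/(1 + ναk²). -/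

import Mathlib

/-- Dispersion relation of the two-layer improved Green–Naghdi model linearized
around a motionless steady state (ζ̄, 0). -/
theorem stmt_13 (γ δ g ν α κ₁ κ₂ ζb fb : ℝ) (hγ0 : 0 ≤ γ) (hγ1 : γ < 1) (hδ : 0 < δ)
    (hg : 0 < g) (hν : 0 < ν) (hα : 1 ≤ α)
    (hh₁ : 0 < 1 - ζb) (hh₂ : 0 < 1 / δ + ζb)
    (hfb : fb = (1 - ζb) * (1 / δ + ζb) / ((1 - ζb) + γ * (1 / δ + ζb)))
    (k : ℝ) (hk : k ≠ 0) (ω : ℂ) :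
    (∃ ζ₀ v₀ : ℂ, (ζ₀, v₀) ≠ (0, 0) ∧
      (-Complex.I * ω * ζ₀ + (fb : ℂ) * Complex.I * (k : ℂ) * v₀ = 0) ∧
      (((1 + ν * α * k ^ 2 : ℝ) : ℂ)
          * (-Complex.I * ω * v₀
            + (((α - 1) / α * (γ + δ) * g : ℝ) : ℂ) * Complex.I * (k : ℂ) * ζ₀)
        + ((1 / α * (γ + δ) * g : ℝ) : ℂ) * Complex.I * (k : ℂ) * ζ₀
        - ((ν * (κ₂ - κ₁) * ζb * k ^ 2 * (γ + δ) * g / (1 + ν * α * k ^ 2) : ℝ) : ℂ)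
            * Complex.I * (k : ℂ) * ζ₀ = 0))
    ↔ ω ^ 2 = ((g * fb * k ^ 2 * (γ + δ)
        * (1 + ν * (α - 1) * k ^ 2 - ν * (κ₂ - κ₁) * k ^ 2 * ζb / (1 + ν * α * k ^ 2))
        / (1 + ν * α * k ^ 2) : ℝ) : ℂ) := by
  have hf : fb ≠ 0 := by
    rw [hfb]; positivity
  have hT : (1 + ν * α * k ^ 2 : ℝ) ≠ 0 := by
    have : 0 < α := by linarith
    positivity
  have ha : α ≠ 0 := by linarith
  obtain ⟨c, hc⟩ : ∃ c : ℝ, c = (γ + δ) * g *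
    (1 + ν * (α - 1) * k ^ 2 - ν * (κ₂ - κ₁) * k ^ 2 * ζb / (1 + ν * α * k ^ 2)) := ⟨_, rfl⟩
  have hR : g * fb * k ^ 2 * (γ + δ)
        * (1 + ν * (α - 1) * k ^ 2 - ν * (κ₂ - κ₁) * k ^ 2 * ζb / (1 + ν * α * k ^ 2))
        / (1 + ν * α * k ^ 2) = fb * k ^ 2 * c / (1 + ν * α * k ^ 2) := by
    rw [hc]; ring
  have hc2 : c = (1 + ν * α * k ^ 2) * ((α - 1) / α * (γ + δ) * g) + 1 / α * (γ + δ) * g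
      - ν * (κ₂ - κ₁) * ζb * k ^ 2 * (γ + δ) * g / (1 + ν * α * k ^ 2) := by
    have h1 : (1 + ν * α * k ^ 2) * ((α - 1) / α * (γ + δ) * g) + 1 / α * (γ + δ) * g
        = (γ + δ) * g * (1 + ν * (α - 1) * k ^ 2) := by
      field_simp
      ring
    rw [h1, hc]; ring
  rw [hR]
  clear hR hc
  generalize (1 + ν * α * k ^ 2 : ℝ) = T at *
  generalize (α - 1) / α * (γ + δ) * g = A at *
  generalize 1 / α * (γ + δ) * g = B at *
  generalize ν * (κ₂ - κ₁) * ζb * k ^ 2 * (γ + δ) * g / T = D at *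
  have hcC : (c : ℂ) = T * A + B - D := by rw [hc2]; push_cast; ring
  have hTC : (T : ℂ) ≠ 0 := by exact_mod_cast hT
  have hfC : (fb : ℂ) ≠ 0 := by exact_mod_cast hf
  have hkC : (k : ℂ) ≠ 0 := by exact_mod_cast hk
  push_cast
  rw [eq_div_iff hTC]
  constructor
  · rintro ⟨z, v, hne, h1, h2⟩
    have e1 : ω * z = fb * k * v := by
      apply mul_left_cancel₀ Complex.I_ne_zero
      linear_combination -h1
    have e2 : T * ω * v = c * k * z := by
      apply mul_left_cancel₀ Complex.I_ne_zero
      rw [hcC]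
      linear_combination -h2
    have hz : z ≠ 0 := by
      rintro rfl
      apply hne
      have : (fb : ℂ) * k * v = 0 := by rw [← e1]; simp
      simp_all
    apply mul_right_cancel₀ hz
    linear_combination T * ω * e1 + fb * k * e2
  · intro h
    refine ⟨fb * k, ω, ?_, by ring, ?_⟩
    · intro h0
      exact mul_ne_zero hfC hkC (Prod.ext_iff.mp h0).1
    · rw [hcC] at h
      linear_combination -Complex.I * h
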